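/- arXiv:2212.01523 — 5 statements merged into one kernel-verified Lean document; each statement's English description precedes it below -/
import Mathlib

section
/- Let 𝒩 be a finite set of N clients, let 𝒮 ⊆ 𝒩 with |𝒮| = S, and let C, K be integers with 0 < C ≤ S and 0 < K − C ≤ N − S. For each client i let p_i be a real weight and Δ_i a vector in a real vector space. Consider the uniform probability distribution over pairs (𝒞, ℛ) where 𝒞 ranges over all subsets of 𝒮 of cardinality C and ℛ ranges over all subsets of 𝒩 ∖ 𝒮 of cardinality K − C (chosen independently and uniformly). Then the expectation of the weighted aggregate ∑_{i ∈ 𝒞} (S/C)·p_i·Δ_i + ∑_{i ∈ ℛ} ((N−S)/(K−C))·p_i·Δ_i equals the full weighted sum ∑_{i ∈ 𝒩} p_i·Δ_i. (Unbiasedness of sticky-sampling aggregation.) -/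
open Finset

theorem sticky_card_aux {ι : Type*} [DecidableEq ι] (s : Finset ι) (n : ℕ) (i : ι) (hi : i ∈ s) :
    ((s.powersetCard (n + 1)).filter (fun A => i ∈ A)).card = (s.card - 1).choose n := by
  rw [← Finset.card_erase_of_mem hi, ← Finset.card_powersetCard]
  refine Finset.card_bij' (fun A _ => A.erase i) (fun A _ => insert i A) ?_ ?_ ?_ ?_
  · intro A hA
    simp only [Finset.mem_filter, Finset.mem_powersetCard] at hA ⊢
    refine ⟨Finset.erase_subset_erase _ hA.1.1, ?_⟩
    rw [Finset.card_erase_of_mem hA.2, hA.1.2]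
    rfl
  · intro A hA
    simp only [Finset.mem_filter, Finset.mem_powersetCard] at hA ⊢
    have hn : i ∉ A := fun h => Finset.notMem_erase i s (hA.1 h)
    refine ⟨⟨Finset.insert_subset hi (hA.1.trans (Finset.erase_subset _ _)), ?_⟩,
      Finset.mem_insert_self _ _⟩
    rw [Finset.card_insert_of_notMem hn, hA.2]
  · intro A hA
    exact Finset.insert_erase (Finset.mem_filter.1 hA).2
  · intro A hA
    have hA' := (Finset.mem_powersetCard.1 hA).1
    exact Finset.erase_insert (fun h => Finset.notMem_erase i s (hA' h))

theorem sticky_sum_aux {ι V : Type*} [DecidableEq ι] [AddCommGroup V] [Module ℝ V]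
    (s : Finset ι) (n : ℕ) (hn : 0 < n) (hns : n ≤ s.card) (p : ι → ℝ) (f : ι → V) :
    ∑ A ∈ s.powersetCard n, ∑ i ∈ A, (((s.card : ℝ) / (n : ℝ)) * p i) • f i
      = (s.card.choose n : ℝ) • ∑ i ∈ s, p i • f i := by
  obtain ⟨n, rfl⟩ : ∃ m, n = m + 1 := ⟨n - 1, by omega⟩
  rw [Finset.sum_comm' (t' := s)
    (s' := fun i => (s.powersetCard (n + 1)).filter (fun A => i ∈ A))]
  · rw [Finset.smul_sum]
    refine Finset.sum_congr rfl fun i hi => ?_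
    rw [Finset.sum_const, sticky_card_aux s n i hi, ← Nat.cast_smul_eq_nsmul ℝ, smul_smul,
      smul_smul]
    congr 1
    obtain ⟨m, hm⟩ : ∃ m, s.card = m + 1 := ⟨s.card - 1, by omega⟩
    rw [hm]
    have h := Nat.add_one_mul_choose_eq m n
    have h' : ((m : ℝ) + 1) * (m.choose n : ℝ) = ((m + 1).choose (n + 1) : ℝ) * ((n : ℝ) + 1) := by
      exact_mod_cast h
    have : (n : ℝ) + 1 ≠ 0 := by positivity
    simp only [Nat.add_sub_cancel]
    push_cast
    field_simp
    linear_combination p i * h'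
  · intro A i
    simp only [Finset.mem_filter, Finset.mem_powersetCard]
    constructor
    · rintro ⟨h1, h2⟩
      exact ⟨⟨h1, h2⟩, h1.1 h2⟩
    · rintro ⟨⟨h1, h2⟩, _⟩
      exact ⟨h1, h2⟩

/-- Unbiasedness of sticky-sampling aggregation: the expectation (uniform average over
all pairs of a size-`C` subset `𝒞` of the sticky group `𝒮` and a size-`K - C` subset `ℛ`
of `𝒩 \ 𝒮`) of the reweighted aggregate equals the full weighted sum. -/
theorem sticky_sampling_unbiased {ι V : Type*} [DecidableEq ι]
    [AddCommGroup V] [Module ℝ V]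
    (𝒩 𝒮 : Finset ι) (h𝒮 : 𝒮 ⊆ 𝒩) (C K : ℕ) (p : ι → ℝ) (Δ : ι → V)
    (hC : 0 < C) (hCS : C ≤ 𝒮.card) (hCK : C < K)
    (hKC : K - C ≤ 𝒩.card - 𝒮.card) :
    (((𝒮.card.choose C : ℝ) * ((𝒩 \ 𝒮).card.choose (K - C) : ℝ))⁻¹) •
      ∑ 𝒞 ∈ 𝒮.powersetCard C, ∑ ℛ ∈ (𝒩 \ 𝒮).powersetCard (K - C),
        ((∑ i ∈ 𝒞, (((𝒮.card : ℝ) / (C : ℝ)) * p i) • Δ i)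
          + ∑ i ∈ ℛ, ((((𝒩.card : ℝ) - (𝒮.card : ℝ)) / ((K : ℝ) - (C : ℝ)) * p i) • Δ i))
      = ∑ i ∈ 𝒩, p i • Δ i := by
  have hcard : (𝒩 \ 𝒮).card = 𝒩.card - 𝒮.card := Finset.card_sdiff_of_subset h𝒮
  have hle : 𝒮.card ≤ 𝒩.card := Finset.card_le_card h𝒮
  have e1 : (𝒩.card : ℝ) - (𝒮.card : ℝ) = ((𝒩 \ 𝒮).card : ℝ) := by
    rw [hcard, Nat.cast_sub hle]
  have e2 : (K : ℝ) - (C : ℝ) = ((K - C : ℕ) : ℝ) := by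
    rw [Nat.cast_sub hCK.le]
  have hD : K - C ≤ (𝒩 \ 𝒮).card := by omega
  rw [e1, e2]
  simp only [Finset.sum_add_distrib, Finset.sum_const, Finset.card_powersetCard]
  rw [← Finset.smul_sum, sticky_sum_aux 𝒮 C hC hCS p Δ,
    sticky_sum_aux (𝒩 \ 𝒮) (K - C) (by omega) hD p Δ, ← Nat.cast_smul_eq_nsmul ℝ,
    ← Nat.cast_smul_eq_nsmul ℝ, smul_smul, smul_smul, mul_comm (Nat.cast _ : ℝ) (Nat.cast (𝒮.card.choose C)),
    ← smul_add, smul_smul, inv_mul_cancel₀, one_smul, add_comm, Finset.sum_sdiff h𝒮]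
  have a1 := Nat.choose_pos hCS
  have a2 := Nat.choose_pos hD
  positivity
end

section
/- Let S, C, K, N be real numbers with 0 < C < K ≤ S < N and (N−S)·K − (K−C)·S ≠ 0. Then for every integer r ≥ 1, (C/S)·((S−K)/S)^{r−1} + ∑_{i=1}^{r−1} (1 − (K−C)/(N−S))^{i−1} · ((K−C)/(N−S)) · ((S−K)/S)^{r−i−1} · ((K−C)/S) = (1/((N−S)·K − (K−C)·S)) · ( (K·(N·C − S·K)/S)·(1 − K/S)^{r−1} + (K−C)^2 · (1 − (K−C)/(N−S))^{r−1} ). (Closed form for the sticky-sampling re-selection probability after r rounds.) -/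
open Finset

/-- Closed form for the sticky-sampling re-selection probability after `r` rounds. -/
theorem sticky_resample_closed_form (S C K N : ℝ)
    (hC : 0 < C) (hCK : C < K) (hKS : K ≤ S) (hSN : S < N)
    (hden : (N - S) * K - (K - C) * S ≠ 0)
    (r : ℕ) (hr : 1 ≤ r) :
    (C / S) * ((S - K) / S) ^ (r - 1)
      + ∑ i ∈ Finset.Icc 1 (r - 1),
          (1 - (K - C) / (N - S)) ^ (i - 1) * ((K - C) / (N - S))
            * ((S - K) / S) ^ (r - i - 1) * ((K - C) / S)
    = (1 / ((N - S) * K - (K - C) * S))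
        * ((K * (N * C - S * K) / S) * (1 - K / S) ^ (r - 1)
            + (K - C) ^ 2 * (1 - (K - C) / (N - S)) ^ (r - 1)) := by
  obtain ⟨m, rfl⟩ : ∃ m, r = m + 1 := ⟨r - 1, by omega⟩
  have hS : S ≠ 0 := by linarith
  have hNS : N - S ≠ 0 := by linarith
  have hb : (S - K) / S = 1 - K / S := by field_simp
  have hsum : ∑ i ∈ Finset.Icc 1 (m + 1 - 1),
          (1 - (K - C) / (N - S)) ^ (i - 1) * ((K - C) / (N - S))
            * ((S - K) / S) ^ (m + 1 - i - 1) * ((K - C) / S)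
      = (∑ i ∈ Finset.range m, (1 - (K - C) / (N - S)) ^ i * (1 - K / S) ^ (m - 1 - i))
          * (((K - C) / (N - S)) * ((K - C) / S)) := by
    rw [Finset.sum_mul, hb, ← Finset.Ico_add_one_right_eq_Icc, Finset.sum_Ico_eq_sum_range]
    apply Finset.sum_congr (by simp)
    intro i _
    rw [show 1 + i - 1 = i by omega, show m + 1 - (1 + i) - 1 = m - 1 - i by omega]
    ring
  have hg := (Commute.all (1 - (K - C) / (N - S)) (1 - K / S)).geom_sum₂_mul m
  rw [hsum, hb, show m + 1 - 1 = m by omega]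
  generalize (∑ i ∈ Finset.range m, (1 - (K - C) / (N - S)) ^ i * (1 - K / S) ^ (m - 1 - i)) = T at *
  have hd : (1 - (K - C) / (N - S)) - (1 - K / S)
      = ((N - S) * K - (K - C) * S) / (S * (N - S)) := by
    field_simp
    ring
  rw [hd] at hg
  have ha : (1 - (K - C) / (N - S)) ^ m = (1 - K / S) ^ m
      + T * (((N - S) * K - (K - C) * S) / (S * (N - S))) := by linarith
  rw [ha]
  generalize (1 - K / S) ^ m = B
  rw [one_div, eq_inv_mul_iff_mul_eq₀ hden]
  field_simp
  ring
end

section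
/- Fix an integer E ≥ 2, reals γ > 0, L_c > 0, σ > 0, a point w ∈ ℝ^d, and a map G : ℝ^d → ℝ^d with ‖G(x)‖ ≤ L_c for all x. Let (ℱ_e)_{e ≥ 0} be a filtration on a probability space and let (x_e)_{e ≥ 0}, (g_e)_{e ≥ 0} be random vectors in ℝ^d such that x_0 = w, x_{e+1} = x_e − γ·g_e, each x_e is ℱ_e-measurable, each g_e is ℱ_{e+1}-measurable, E[g_e ∣ ℱ_e] = G(x_e) almost surely, and E[‖g_e − G(x_e)‖² ∣ ℱ_e] ≤ σ² almost surely. Then for every e with 0 ≤ e ≤ E, E[ ‖x_e − w‖² ] ≤ 3·E·( E·γ²·L_c² + γ²·σ² ). (Bounded drift of local SGD iterates from the global model.) -/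
open MeasureTheory

theorem sq_integrable_aux {V : Type*} [NormedAddCommGroup V] {Ω : Type*}
    {m0 : MeasurableSpace Ω} {μ : Measure Ω} {f : Ω → V} (hf : MemLp f 2 μ) :
    Integrable (fun ω => ‖f ω‖ ^ 2) μ :=
  (memLp_two_iff_integrable_sq_norm hf.1).1 hf

theorem pythag_aux {V : Type*} [NormedAddCommGroup V] [InnerProductSpace ℝ V] [CompleteSpace V]
    {Ω : Type*} {m m0 : MeasurableSpace Ω} {μ : Measure Ω} [IsProbabilityMeasure μ] (hm : m ≤ m0)
    {M n : Ω → V} (hMm : StronglyMeasurable[m] M) (hM : MemLp M 2 μ) (hn : MemLp n 2 μ)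
    (h0 : μ[n | m] =ᵐ[μ] 0) :
    ∫ ω, ‖M ω + n ω‖ ^ 2 ∂μ = ∫ ω, ‖M ω‖ ^ 2 ∂μ + ∫ ω, ‖n ω‖ ^ 2 ∂μ := by
  have i1 := sq_integrable_aux hM
  have i2 := sq_integrable_aux hn
  have i3 : Integrable (fun ω => ‖M ω + n ω‖ ^ 2) μ := sq_integrable_aux (hM.add hn)
  have i4 : Integrable (fun ω => innerSL ℝ (M ω) (n ω)) μ := by
    refine (((i3.sub i1).sub i2).const_mul (1 / 2)).congr (ae_of_all _ fun ω => ?_)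
    simp only [Pi.sub_apply, innerSL_apply_apply]
    rw [norm_add_sq_real]
    ring
  have h := condExp_bilin_of_stronglyMeasurable_left (innerSL ℝ) hMm i4 (hn.integrable (by norm_num))
  have hz : ∫ ω, innerSL ℝ (M ω) (n ω) ∂μ = 0 := by
    rw [← integral_condExp hm, integral_congr_ae h]
    rw [← integral_zero Ω ℝ (μ := μ)]
    refine integral_congr_ae ?_
    filter_upwards [h0] with ω hω
    simp [hω]
  have e : (fun ω => ‖M ω + n ω‖ ^ 2)
      = fun ω => (‖M ω‖ ^ 2 + 2 * innerSL ℝ (M ω) (n ω)) + ‖n ω‖ ^ 2 := by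
    funext ω
    rw [norm_add_sq_real]
    simp
  have i5 : Integrable (fun ω => ‖M ω‖ ^ 2 + 2 * innerSL ℝ (M ω) (n ω)) μ :=
    i1.add (i4.const_mul 2)
  rw [e, integral_add i5 i2, integral_add i1 (i4.const_mul 2),
    integral_const_mul, hz]
  ring

/-- Bounded drift of local SGD iterates from the global model: starting from `w`, after at
most `E` stochastic gradient steps with step size `γ`, unbiased gradients with conditional
variance at most `σ²`, and true gradients bounded by `L_c`, the expected squared distance
to `w` is at most `3 E (E γ² L_c² + γ² σ²)`. -/
theorem local_sgd_drift_bound {d : ℕ} {Ω : Type*} {m0 : MeasurableSpace Ω}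
    (μ : Measure Ω) [IsProbabilityMeasure μ] (ℱ : Filtration ℕ m0)
    (E : ℕ) (hE : 2 ≤ E) (γ Lc σ : ℝ) (hγ : 0 < γ) (hLc : 0 < Lc) (hσ : 0 < σ)
    (w : EuclideanSpace ℝ (Fin d)) (G : EuclideanSpace ℝ (Fin d) → EuclideanSpace ℝ (Fin d))
    (hG : ∀ x, ‖G x‖ ≤ Lc)
    (x g : ℕ → Ω → EuclideanSpace ℝ (Fin d))
    (hx0 : x 0 = fun _ => w)
    (hstep : ∀ e, x (e + 1) = fun ω => x e ω - γ • g e ω)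
    (hxmeas : ∀ e, StronglyMeasurable[ℱ e] (x e))
    (hgmeas : ∀ e, StronglyMeasurable[ℱ (e + 1)] (g e))
    (hgmem : ∀ e, MemLp (g e) 2 μ)
    (hunbiased : ∀ e, μ[g e | ℱ e] =ᵐ[μ] fun ω => G (x e ω))
    (hcondvar : ∀ e, ∀ᵐ ω ∂μ,
        (μ[fun ω' => ‖g e ω' - G (x e ω')‖ ^ 2 | ℱ e]) ω ≤ σ ^ 2) :
    ∀ e ≤ E, ∫ ω, ‖x e ω - w‖ ^ 2 ∂μ
        ≤ 3 * (E : ℝ) * ((E : ℝ) * γ ^ 2 * Lc ^ 2 + γ ^ 2 * σ ^ 2) := by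
  have key : ∀ e : ℕ, ∃ M : Ω → EuclideanSpace ℝ (Fin d), StronglyMeasurable[ℱ e] M ∧
      MemLp M 2 μ ∧ ∫ ω, ‖M ω‖ ^ 2 ∂μ ≤ e * σ ^ 2 ∧
      ∀ᵐ ω ∂μ, ‖x e ω - w + γ • M ω‖ ≤ e * (γ * Lc) := by
    intro e
    induction e with
    | zero =>
      refine ⟨fun _ => 0, stronglyMeasurable_const, MemLp.zero', by simp, ?_⟩
      simp [hx0]
    | succ e ih =>
      obtain ⟨M, hMm, hM, hMσ, hMx⟩ := ih
      have hle : ℱ e ≤ ℱ (e + 1) := ℱ.mono (Nat.le_succ e)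
      have hh : MemLp (μ[g e | ℱ e]) 2 μ := (hgmem e).condExp (by norm_num)
      have hn : MemLp (g e - μ[g e | ℱ e]) 2 μ := (hgmem e).sub hh
      have h0 : μ[g e - μ[g e | ℱ e] | ℱ e] =ᵐ[μ] 0 := by
        have h1 := condExp_sub ((hgmem e).integrable (by norm_num))
          (integrable_condExp (m := ℱ e) (f := g e) (μ := μ)) (ℱ e)
        rw [condExp_of_stronglyMeasurable (ℱ.le e) stronglyMeasurable_condExp
          integrable_condExp, sub_self] at h1
        exact h1
      have hv : ∫ ω, ‖(g e - μ[g e | ℱ e]) ω‖ ^ 2 ∂μ ≤ σ ^ 2 := by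
        have hc : (fun ω => ‖(g e - μ[g e | ℱ e]) ω‖ ^ 2)
            =ᵐ[μ] fun ω' => ‖g e ω' - G (x e ω')‖ ^ 2 := by
          filter_upwards [hunbiased e] with ω hω
          simp [hω]
        rw [integral_congr_ae hc, ← integral_condExp (ℱ.le e)]
        calc _ ≤ ∫ _, σ ^ 2 ∂μ :=
              integral_mono_ae integrable_condExp (integrable_const _) (hcondvar e)
          _ = σ ^ 2 := by simp
      refine ⟨fun ω => M ω + (g e - μ[g e | ℱ e]) ω, ?_, hM.add hn, ?_, ?_⟩
      · exact (hMm.mono hle).add ((hgmeas e).sub (stronglyMeasurable_condExp.mono hle))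
      · rw [pythag_aux (ℱ.le e) hMm hM hn h0]
        push_cast
        linarith
      · filter_upwards [hMx, hunbiased e] with ω h1 h2
        have : x (e + 1) ω - w + γ • (M ω + (g e - μ[g e | ℱ e]) ω)
            = (x e ω - w + γ • M ω) - γ • G (x e ω) := by
          rw [hstep e, Pi.sub_apply, h2]
          simp only [smul_add, smul_sub]
          abel
        rw [this]
        refine (norm_sub_le _ _).trans ?_
        rw [norm_smul, Real.norm_of_nonneg hγ.le]
        have := mul_le_mul_of_nonneg_left (hG (x e ω)) hγ.le
        push_cast
        linarith
  intro e he
  obtain ⟨M, -, hM, hMσ, hMx⟩ := key e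
  have heE : (e : ℝ) ≤ E := by exact_mod_cast he
  have he0 : (0 : ℝ) ≤ e := Nat.cast_nonneg e
  have i1 := sq_integrable_aux hM
  have hb : ∫ ω, ‖x e ω - w‖ ^ 2 ∂μ
      ≤ ∫ ω, (2 * (e * (γ * Lc)) ^ 2 + 2 * γ ^ 2 * ‖M ω‖ ^ 2) ∂μ := by
    refine integral_mono_of_nonneg (ae_of_all _ fun ω => by positivity)
      ((integrable_const _).add (i1.const_mul _)) ?_
    filter_upwards [hMx] with ω hω
    have h1 : ‖x e ω - w‖ ≤ e * (γ * Lc) + γ * ‖M ω‖ := by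
      have h2 := norm_sub_le (x e ω - w + γ • M ω) (γ • M ω)
      rw [add_sub_cancel_right, norm_smul, Real.norm_of_nonneg hγ.le] at h2
      linarith
    have h3 := pow_le_pow_left₀ (norm_nonneg _) h1 2
    nlinarith [sq_nonneg (e * (γ * Lc) - γ * ‖M ω‖)]
  rw [integral_add (integrable_const _) (i1.const_mul _)] at hb
  simp only [integral_const, probReal_univ, one_smul] at hb
  rw [integral_const_mul] at hb
  have hA : (e * (γ * Lc)) ^ 2 ≤ (E * (γ * Lc)) ^ 2 := by gcongr
  have hB : γ ^ 2 * ∫ ω, ‖M ω‖ ^ 2 ∂μ ≤ γ ^ 2 * (E * σ ^ 2) := by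
    refine mul_le_mul_of_nonneg_left (hMσ.trans ?_) (by positivity)
    gcongr
  have hC : 0 ≤ (E * (γ * Lc)) ^ 2 := by positivity
  have hD : 0 ≤ γ ^ 2 * (E * σ ^ 2) := by positivity
  nlinarith
end

section
/- Let N, S, C, K be integers with 0 < C, 0 < K − C, and 0 < S < N. Let 𝒮 be a subset of the index set {1, …, N} with |𝒮| = S, and let α_1, …, α_N be vectors in a finite-dimensional real inner product space. Let i_1, …, i_C be i.i.d. uniform random elements of 𝒮 and j_1, …, j_{K−C} be i.i.d. uniform random elements of {1, …, N} ∖ 𝒮, with all K random indices mutually independent. Then E[ ‖ (S/C)·∑_{k=1}^{C} α_{i_k} + ((N−S)/(K−C))·∑_{l=1}^{K−C} α_{j_l} ‖² ] ≤ (S/C)·∑_{i ∈ 𝒮} ‖α_i‖² + ((N−S)/(K−C))·∑_{i ∉ 𝒮} ‖α_i‖² + ‖ ∑_{i=1}^{N} α_i ‖². (Second-moment bound for the reweighted sticky-sampling aggregate.) -/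
open Finset
open scoped BigOperators

theorem aux_expand {E ι κ : Type*} [NormedAddCommGroup E] [InnerProductSpace ℝ E]
    (s : Finset ι) (t : Finset κ) (u : ι → E) (v : κ → E) :
    ∑ x ∈ s, ∑ y ∈ t, ‖u x + v y‖ ^ 2 =
      (t.card : ℝ) * ∑ x ∈ s, ‖u x‖ ^ 2 + 2 * inner ℝ (∑ x ∈ s, u x) (∑ y ∈ t, v y)
        + (s.card : ℝ) * ∑ y ∈ t, ‖v y‖ ^ 2 := by
  simp only [norm_add_sq_real, Finset.sum_add_distrib, Finset.sum_const, nsmul_eq_mul,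
    sum_inner, inner_sum, Finset.mul_sum]
  rw [Finset.sum_comm (s := s) (t := t)]

theorem aux_cons {M β : Type*} [AddCommMonoid M] (n : ℕ) (s : Finset β)
    (F : (Fin (n + 1) → β) → M) :
    ∑ f ∈ Fintype.piFinset (fun _ : Fin (n + 1) => s), F f =
      ∑ a ∈ s, ∑ g ∈ Fintype.piFinset (fun _ : Fin n => s), F (Fin.cons a g) := by
  rw [← Finset.sum_product']
  refine Finset.sum_nbij' (fun f => (f 0, Fin.tail f)) (fun p => Fin.cons p.1 p.2) ?_ ?_ ?_ ?_ ?_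
  · intro f hf
    simp only [Fintype.mem_piFinset, Finset.mem_product] at hf ⊢
    exact ⟨hf 0, fun i => hf i.succ⟩
  · rintro ⟨a, g⟩ h
    simp only [Fintype.mem_piFinset, Finset.mem_product] at h ⊢
    intro i
    refine Fin.cases ?_ (fun j => ?_) i
    · simpa using h.1
    · simpa using h.2 j
  · intro f _
    simp
  · rintro ⟨a, g⟩ _
    simp
  · intro f _
    simp

theorem aux_first {E β : Type*} [NormedAddCommGroup E] [InnerProductSpace ℝ E]
    (s : Finset β) (α : β → E) (n : ℕ) :
    (s.card : ℝ) • ∑ f ∈ Fintype.piFinset (fun _ : Fin n => s), ∑ k, α (f k) =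
      ((n : ℝ) * (s.card : ℝ) ^ n) • ∑ i ∈ s, α i := by
  induction n with
  | zero => simp
  | succ n ih =>
    rw [aux_cons]
    simp only [Fin.sum_univ_succ, Fin.cons_zero, Fin.cons_succ, Finset.sum_add_distrib,
      Finset.sum_const, Fintype.card_piFinset_const, ← Finset.smul_sum]
    simp only [← Nat.cast_smul_eq_nsmul ℝ, ← Finset.smul_sum]
    rw [smul_add, ih, smul_smul, smul_smul, ← add_smul]
    congr 1
    push_cast
    ring

theorem aux_second {E β : Type*} [NormedAddCommGroup E] [InnerProductSpace ℝ E]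
    (s : Finset β) (α : β → E) (n : ℕ) :
    (s.card : ℝ) ^ 2 * ∑ f ∈ Fintype.piFinset (fun _ : Fin n => s), ‖∑ k, α (f k)‖ ^ 2 =
      (s.card : ℝ) ^ n * ((n : ℝ) * s.card * ∑ i ∈ s, ‖α i‖ ^ 2
        + (n : ℝ) * ((n : ℝ) - 1) * ‖∑ i ∈ s, α i‖ ^ 2) := by
  induction n with
  | zero => simp
  | succ n ih =>
    rw [aux_cons]
    simp only [Fin.sum_univ_succ, Fin.cons_zero, Fin.cons_succ]
    rw [aux_expand s _ α (fun g : Fin n → β => ∑ k, α (g k)), Fintype.card_piFinset_const]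
    have h := congrArg (fun v => inner ℝ (∑ i ∈ s, α i) v) (aux_first s α n)
    simp only [inner_smul_right, real_inner_self_eq_norm_sq] at h
    push_cast
    linear_combination (s.card : ℝ) * ih + 2 * (s.card : ℝ) * h

/-- Second-moment bound for the reweighted sticky-sampling aggregate: `C` indices are drawn
i.i.d. uniformly from the sticky group `𝒮` (of size `S`) and `K − C` indices i.i.d. uniformly
from its complement (of size `N − S`), independently; the expectation (written as the uniform
average over all such tuples of indices) of the squared norm of the inverse-propensity
weighted aggregate is bounded as stated. -/
theorem sticky_aggregate_second_moment {E : Type*}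
    [NormedAddCommGroup E] [InnerProductSpace ℝ E]
    (N S C K : ℕ) (hC : 0 < C) (hCK : C < K) (hS : 0 < S) (hSN : S < N)
    (𝒮 : Finset (Fin N)) (hcard : 𝒮.card = S) (α : Fin N → E) :
    (((S : ℝ) ^ C * ((N : ℝ) - (S : ℝ)) ^ (K - C))⁻¹) *
      ∑ f ∈ Fintype.piFinset (fun _ : Fin C => 𝒮),
        ∑ g ∈ Fintype.piFinset (fun _ : Fin (K - C) => 𝒮ᶜ),
          ‖((S : ℝ) / (C : ℝ)) • ∑ k, α (f k)
            + (((N : ℝ) - (S : ℝ)) / ((K : ℝ) - (C : ℝ))) • ∑ l, α (g l)‖ ^ 2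
    ≤ ((S : ℝ) / (C : ℝ)) * ∑ i ∈ 𝒮, ‖α i‖ ^ 2
        + (((N : ℝ) - (S : ℝ)) / ((K : ℝ) - (C : ℝ))) * ∑ i ∈ 𝒮ᶜ, ‖α i‖ ^ 2
        + ‖∑ i, α i‖ ^ 2 := by
  have hmem : ((𝒮ᶜ).card : ℝ) = (N : ℝ) - S := by
    rw [Finset.card_compl, Fintype.card_fin, hcard, Nat.cast_sub hSN.le]
  have hL : ((K - C : ℕ) : ℝ) = (K : ℝ) - C := Nat.cast_sub hCK.le
  have hLpos : 0 < K - C := Nat.sub_pos_of_lt hCK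
  have hT : (0 : ℝ) < (N : ℝ) - S := sub_pos.2 (by exact_mod_cast hSN)
  have f1 := aux_first 𝒮 α C
  have f2 := aux_first 𝒮ᶜ α (K - C)
  have s1 := aux_second 𝒮 α C
  have s2 := aux_second 𝒮ᶜ α (K - C)
  rw [aux_expand _ _ (fun f : Fin C → Fin N => ((S : ℝ) / (C : ℝ)) • ∑ k, α (f k))
    (fun g : Fin (K - C) → Fin N =>
      (((N : ℝ) - (S : ℝ)) / ((K : ℝ) - (C : ℝ))) • ∑ l, α (g l)),
    Fintype.card_piFinset_const, Fintype.card_piFinset_const,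
    ← Finset.sum_add_sum_compl 𝒮 α, norm_add_sq_real (∑ i ∈ 𝒮, α i)]
  push_cast
  rw [hmem] at *
  rw [hcard] at *
  rw [← hL]
  rw [hL] at hL
  generalize K - C = L at *
  generalize (N : ℝ) - S = T at *
  have hC' : (0 : ℝ) < C := by exact_mod_cast hC
  have hS' : (0 : ℝ) < S := by exact_mod_cast hS
  have hL' : (0 : ℝ) < L := by exact_mod_cast hLpos
  have g1 : ∑ f ∈ Fintype.piFinset (fun _ : Fin C => 𝒮), ((S : ℝ) / (C : ℝ)) • ∑ k, α (f k)
      = (S : ℝ) ^ C • ∑ i ∈ 𝒮, α i := by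
    rw [← Finset.smul_sum, div_eq_inv_mul, mul_smul, f1, smul_smul]
    congr 1
    field_simp
  have g2 : ∑ f ∈ Fintype.piFinset (fun _ : Fin L => 𝒮ᶜ), (T / (L : ℝ)) • ∑ k, α (f k)
      = T ^ L • ∑ i ∈ 𝒮ᶜ, α i := by
    rw [← Finset.smul_sum, div_eq_inv_mul, mul_smul, f2, smul_smul]
    congr 1
    field_simp
  rw [g1, g2]
  simp only [norm_smul, mul_pow, ← Finset.mul_sum, inner_smul_left, inner_smul_right,
    Real.norm_eq_abs, sq_abs, div_pow]
  simp only [div_mul_eq_mul_div, s1, s2]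
  have p1 : 0 ≤ ‖∑ i ∈ 𝒮, α i‖ ^ 2 / C := by positivity
  have p2 : 0 ≤ ‖∑ i ∈ 𝒮ᶜ, α i‖ ^ 2 / L := by positivity
  generalize ‖∑ i ∈ 𝒮, α i‖ ^ 2 = a at *
  generalize ‖∑ i ∈ 𝒮ᶜ, α i‖ ^ 2 = b at *
  generalize ∑ i ∈ 𝒮, ‖α i‖ ^ 2 = q at *
  generalize ∑ i ∈ 𝒮ᶜ, ‖α i‖ ^ 2 = r at *
  generalize inner ℝ (∑ i ∈ 𝒮, α i) (∑ i ∈ 𝒮ᶜ, α i) = w at *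
  refine le_of_eq_of_le (b := S * q / C + T * r / L + (a + 2 * w + b) - a / C - b / L) ?_
    (by linarith)
  simp only [conj_trivial]
  have hSC : (S : ℝ) ^ C ≠ 0 := by positivity
  have hTL : T ^ L ≠ 0 := by positivity
  generalize (S : ℝ) ^ C = x at *
  generalize T ^ L = y at *
  field_simp
  ring
end

section
/- Let d, N, E be positive integers, let γ > 0 and L_s > 0 be reals, and let p_1, …, p_N be nonnegative reals with ∑_{i=1}^{N} p_i = 1. Let F_1, …, F_N : ℝ^d → ℝ be differentiable functions whose gradients ∇F_i are L_s-Lipschitz, and set F = ∑_{i=1}^{N} p_i·F_i. Then for every point w ∈ ℝ^d and every family of points (x_{i,e}) ∈ ℝ^d indexed by i ∈ {1,…,N} and e ∈ {0,…,E−1}, ⟨ ∇F(w), −γ·∑_{i=1}^{N} p_i ∑_{e=0}^{E−1} ∇F_i(x_{i,e}) ⟩ ≤ −(γE/2)·‖∇F(w)‖² − (γ/(2E))·‖ ∑_{i=1}^{N} ∑_{e=0}^{E−1} p_i·∇F_i(x_{i,e}) ‖² + (γ·L_s²/2)·∑_{i=1}^{N} ∑_{e=0}^{E−1} p_i·‖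 w − x_{i,e} ‖². -/
open Finset
open scoped BigOperators RealInnerProductSpace

/-- Deterministic core of the descent-direction bound for federated averaging: the inner
product of the global gradient with the (negated, weighted) sum of local gradients is
bounded by a negative gradient-norm term, a negative averaged-local-gradient term, and the
accumulated local drift. -/
theorem fedavg_descent_direction_bound (d N E : ℕ) (hd : 0 < d) (hN : 0 < N) (hE : 0 < E)
    (γ Ls : ℝ) (hγ : 0 < γ) (hLs : 0 < Ls)
    (p : Fin N → ℝ) (hp : ∀ i, 0 ≤ p i) (hpsum : ∑ i, p i = 1)
    (F : Fin N → EuclideanSpace ℝ (Fin d) → ℝ)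
    (hdiff : ∀ i, Differentiable ℝ (F i))
    (hlip : ∀ i x y, ‖gradient (F i) x - gradient (F i) y‖ ≤ Ls * ‖x - y‖)
    (w : EuclideanSpace ℝ (Fin d)) (x : Fin N → ℕ → EuclideanSpace ℝ (Fin d)) :
    ⟪gradient (fun z => ∑ i, p i * F i z) w,
        (-γ) • ∑ i, p i • ∑ e ∈ Finset.range E, gradient (F i) (x i e)⟫
      ≤ -(γ * (E : ℝ) / 2) * ‖gradient (fun z => ∑ i, p i * F i z) w‖ ^ 2
        - (γ / (2 * (E : ℝ)))
            * ‖∑ i, ∑ e ∈ Finset.range E, p i • gradient (F i) (x i e)‖ ^ 2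
        + (γ * Ls ^ 2 / 2) * ∑ i, ∑ e ∈ Finset.range E, p i * ‖w - x i e‖ ^ 2 := by
  have hG : gradient (fun z => ∑ i, p i * F i z) w = ∑ i, p i • gradient (F i) w := by
    apply HasGradientAt.gradient
    rw [hasGradientAt_iff_hasFDerivAt]
    have h : HasFDerivAt (fun z => ∑ i, p i * F i z)
        (∑ i, p i • (InnerProductSpace.toDual ℝ (EuclideanSpace ℝ (Fin d))
          (gradient (F i) w))) w := by
      apply HasFDerivAt.fun_sum
      intro i _
      exact ((hdiff i w).hasGradientAt.hasFDerivAt).const_mul (p i)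
    simpa [map_sum] using h
  have hS : ∑ i, p i • ∑ e ∈ Finset.range E, gradient (F i) (x i e)
      = ∑ i, ∑ e ∈ Finset.range E, p i • gradient (F i) (x i e) := by
    simp only [Finset.smul_sum]
  rw [hS]
  have hE' : (0 : ℝ) < E := by exact_mod_cast hE
  have hD : (E : ℝ) • gradient (fun z => ∑ i, p i * F i z) w
      - ∑ i, ∑ e ∈ Finset.range E, p i • gradient (F i) (x i e)
      = ∑ i, ∑ e ∈ Finset.range E, p i • (gradient (F i) w - gradient (F i) (x i e)) := by
    rw [hG]
    simp only [smul_sub, Finset.sum_sub_distrib, Finset.sum_const, Finset.card_range,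
      Finset.smul_sum, Nat.cast_smul_eq_nsmul]
  have hn : ‖∑ i, ∑ e ∈ Finset.range E, p i • (gradient (F i) w - gradient (F i) (x i e))‖
      ≤ ∑ i, ∑ e ∈ Finset.range E, p i * (Ls * ‖w - x i e‖) := by
    refine (norm_sum_le _ _).trans (Finset.sum_le_sum fun i _ => ?_)
    refine (norm_sum_le _ _).trans (Finset.sum_le_sum fun e _ => ?_)
    rw [norm_smul, Real.norm_of_nonneg (hp i)]
    exact mul_le_mul_of_nonneg_left (hlip i _ _) (hp i)
  have hcs : (∑ i, ∑ e ∈ Finset.range E, p i * (Ls * ‖w - x i e‖)) ^ 2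
      ≤ E * (Ls ^ 2 * ∑ i, ∑ e ∈ Finset.range E, p i * ‖w - x i e‖ ^ 2) := by
    have h := Finset.sum_sq_le_sum_mul_sum_of_sq_eq_mul
      (Finset.univ ×ˢ Finset.range E : Finset (Fin N × ℕ))
      (r := fun q => p q.1 * (Ls * ‖w - x q.1 q.2‖))
      (f := fun q => p q.1) (g := fun q => p q.1 * (Ls ^ 2 * ‖w - x q.1 q.2‖ ^ 2))
      (fun q _ => hp q.1)
      (fun q _ => mul_nonneg (hp q.1) (by positivity)) (fun q _ => by ring)
    simp only [Finset.sum_product] at h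
    have h1 : ∑ i, ∑ _e ∈ Finset.range E, p i = (E : ℝ) := by
      simp [← Finset.mul_sum, hpsum]
    rw [h1] at h
    refine h.trans (le_of_eq ?_)
    simp only [Finset.mul_sum]
    refine Finset.sum_congr rfl fun i _ => Finset.sum_congr rfl fun e _ => by ring
  rw [← hD] at hn
  have hsq := (pow_le_pow_left₀ (norm_nonneg _) hn 2).trans hcs
  generalize gradient (fun z => ∑ i, p i * F i z) w = G at hsq ⊢
  generalize ∑ i, ∑ e ∈ Finset.range E, p i • gradient (F i) (x i e) = S at hsq ⊢
  generalize ∑ i, ∑ e ∈ Finset.range E, p i * ‖w - x i e‖ ^ 2 = T at hsq ⊢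
  rw [norm_sub_sq_real, norm_smul, real_inner_smul_left, Real.norm_of_nonneg hE'.le] at hsq
  rw [real_inner_smul_right]
  have key := mul_le_mul_of_nonneg_left hsq (show 0 ≤ γ / (2 * (E : ℝ)) by positivity)
  have e1 : γ / (2 * (E : ℝ)) * ((E * ‖G‖) ^ 2 - 2 * (E * ⟪G, S⟫) + ‖S‖ ^ 2)
      = γ * E / 2 * ‖G‖ ^ 2 - γ * ⟪G, S⟫ + γ / (2 * (E : ℝ)) * ‖S‖ ^ 2 := by
    field_simp
  have e2 : γ / (2 * (E : ℝ)) * (E * (Ls ^ 2 * T)) = γ * Ls ^ 2 / 2 * T := by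
    field_simp
  rw [e1, e2] at key
  linarith
end
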